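/- arXiv:2604.02439 — 2 statements merged into one kernel-verified Lean document; each statement's English description precedes it below -/
import Mathlib

section
/- Existence of witnesses for states without the r-absolute Schmidt number property: if σ is a density matrix on ℂ^d ⊗ ℂ^d with σ ∉ r-ABSN, then there exists a Hermitian (d²)×(d²) matrix W such that Re Tr(W ρ) ≥ 0 for every ρ ∈ r-ABSN and Re Tr(W σ) < 0. -/
open Matrix BigOperators
open scoped ComplexOrder

/-- The space of complex matrices acting on `ℂ^d ⊗ ℂ^d`. -/
abbrev MatD (d : ℕ) := Matrix (Fin d × Fin d) (Fin d × Fin d) ℂ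

/-- A density matrix on `ℂ^d ⊗ ℂ^d`: positive semidefinite with trace 1. -/
def IsDensity (d : ℕ) (ρ : MatD d) : Prop :=
  ρ.PosSemidef ∧ ρ.trace = 1

/-- `ρ` has Schmidt number at most `r`: it is a finite convex combination of rank-one
projections onto unit vectors `ψ_k` whose Schmidt rank (the rank of the associated
`d × d` matrix) is at most `r`. -/
def InSchmidt (d r : ℕ) (ρ : MatD d) : Prop :=
  ∃ (n : ℕ) (p : Fin n → ℝ) (ψ : Fin n → (Fin d × Fin d) → ℂ),
    (∀ k, 0 ≤ p k) ∧ (∑ k, p k = 1) ∧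
    (∀ k, ∑ x, Complex.normSq (ψ k x) = 1) ∧
    (∀ k, (Matrix.of (fun i j => ψ k (i, j))).rank ≤ r) ∧
    ρ = ∑ k, (p k : ℂ) • Matrix.vecMulVec (ψ k) (star (ψ k))

/-- `ρ` belongs to `r`-ABSN: it is a density matrix and `U ρ U†` has Schmidt number
at most `r` for every global unitary `U`. -/
def InABSN (d r : ℕ) (ρ : MatD d) : Prop :=
  IsDensity d ρ ∧
  ∀ U ∈ Matrix.unitaryGroup (Fin d × Fin d) ℂ, InSchmidt d r (U * ρ * star U)

/-- In a finite-dimensional space, the convex hull of a compact set is compact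
(a consequence of Carathéodory's theorem). -/
theorem isCompact_convexHull_of_isCompact {E : Type*} [AddCommGroup E] [Module ℝ E]
    [TopologicalSpace E] [ContinuousAdd E] [ContinuousSMul ℝ E] [FiniteDimensional ℝ E]
    {s : Set E} (hs : IsCompact s) : IsCompact (convexHull ℝ s) := by
  rcases s.eq_empty_or_nonempty with rfl | ⟨x₀, hx₀⟩
  · simp
  let N := Module.finrank ℝ E + 1
  let F : (Fin N → ℝ) × (Fin N → E) → E := fun q => ∑ i, q.1 i • q.2 i
  have hF : Continuous F := by fun_prop
  have hK : IsCompact (stdSimplex ℝ (Fin N) ×ˢ Set.univ.pi fun _ : Fin N => s) :=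
    (isCompact_stdSimplex ℝ (Fin N)).prod (isCompact_univ_pi fun _ => hs)
  convert hK.image hF using 1
  ext x
  constructor
  · intro hx
    obtain ⟨ι, _, z, w, hz, hind, hw, hw1, rfl⟩ := eq_pos_convex_span_of_mem_convexHull hx
    have hcard : Fintype.card ι ≤ Fintype.card (Fin N) := by
      rw [Fintype.card_fin]
      exact hind.card_le_finrank_succ.trans (Nat.succ_le_succ (Submodule.finrank_le _))
    obtain ⟨e⟩ := Function.Embedding.nonempty_of_card_le hcard
    have hext : ∀ j, j ∉ Set.range e → Function.extend e w 0 j = 0 := fun j hj => by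
      rw [Function.extend_apply' _ _ _ hj, Pi.zero_apply]
    refine ⟨(Function.extend e w 0, Function.extend e z fun _ => x₀), ⟨⟨fun j => ?_, ?_⟩, ?_⟩, ?_⟩
    · by_cases hj : j ∈ Set.range e
      · obtain ⟨i, rfl⟩ := hj
        simpa [e.injective.extend_apply] using (hw i).le
      · exact (hext j hj).ge
    · rw [← hw1]
      exact (Fintype.sum_of_injective e e.injective _ _ hext
        fun i => (e.injective.extend_apply w 0 i).symm).symm
    · intro j _
      by_cases hj : j ∈ Set.range e
      · obtain ⟨i, rfl⟩ := hj
        simpa [e.injective.extend_apply] using hz ⟨i, rfl⟩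
      · simpa [Function.extend_apply' _ _ _ hj] using hx₀
    · refine (Fintype.sum_of_injective e e.injective _ _ (fun j hj => ?_) fun i => ?_).symm
      · simp [hext j hj]
      · simp [e.injective.extend_apply]
  · rintro ⟨⟨w, z⟩, ⟨⟨hw, hw1⟩, hz⟩, rfl⟩
    exact mem_convexHull_of_exists_fintype w z hw hw1 (fun i => hz i (Set.mem_univ i)) rfl

/-- The matrices of rank at most `r` form a closed set. -/
theorem isClosed_setOf_matrix_rank_le {m n : Type*} [Fintype m] [Fintype n] (r : ℕ) :
    IsClosed {A : Matrix m n ℂ | A.rank ≤ r} := by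
  classical
  let L : Matrix m n ℂ →ₗ[ℂ] ((n → ℂ) →L[ℂ] (m → ℂ)) :=
    LinearMap.toContinuousLinearMap.toLinearMap ∘ₗ
      (Matrix.toLin' : Matrix m n ℂ ≃ₗ[ℂ] _).toLinearMap
  have hL : Continuous L := L.continuous_of_finiteDimensional
  have hopen :=
    (isOpen_setOfPred_nat_le_rank (𝕜 := ℂ) (E := n → ℂ) (F := m → ℂ) (r + 1)).preimage hL
  rw [← isOpen_compl_iff]
  convert hopen using 1
  ext A
  have hrank : LinearMap.rank ((L A : (n → ℂ) →L[ℂ] (m → ℂ)) : (n → ℂ) →ₗ[ℂ] (m → ℂ))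
      = (A.rank : Cardinal) := by
    rw [Matrix.rank, Module.finrank_eq_rank]
    rfl
  simp only [Set.mem_compl_iff, Set.mem_ofPred_eq, Set.mem_preimage, hrank, not_le]
  norm_cast

/-- Unit vectors of `ℂ^d ⊗ ℂ^d` with Schmidt rank at most `r`. -/
def schmidtUnitVectors (d r : ℕ) : Set (Fin d × Fin d → ℂ) :=
  {ψ | ∑ x, Complex.normSq (ψ x) = 1 ∧ (Matrix.of fun i j => ψ (i, j)).rank ≤ r}

theorem isCompact_schmidtUnitVectors (d r : ℕ) : IsCompact (schmidtUnitVectors d r) := by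
  refine Metric.isCompact_of_isClosed_isBounded ?_ ?_
  · refine IsClosed.inter (isClosed_eq (by fun_prop) continuous_const) ?_
    exact (isClosed_setOf_matrix_rank_le (m := Fin d) (n := Fin d) r).preimage
      (f := fun ψ : Fin d × Fin d → ℂ => Matrix.of fun i j => ψ (i, j))
      (continuous_matrix fun i j => continuous_apply (i, j))
  · refine (Metric.isBounded_closedBall (x := (0 : Fin d × Fin d → ℂ)) (r := 1)).subset ?_
    rintro ψ ⟨hψ, -⟩
    rw [mem_closedBall_zero_iff, pi_norm_le_iff_of_nonneg zero_le_one]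
    intro x
    have h : Complex.normSq (ψ x) ≤ 1 := hψ ▸ Finset.single_le_sum
      (f := fun x => Complex.normSq (ψ x)) (fun y _ => Complex.normSq_nonneg _) (Finset.mem_univ x)
    rw [Complex.normSq_eq_norm_sq] at h
    exact (sq_le_one_iff₀ (norm_nonneg _)).1 h

/-- The states of Schmidt number at most `r` are the convex hull of the rank-one projections
onto unit vectors of Schmidt rank at most `r`. -/
theorem setOf_inSchmidt_eq_convexHull (d r : ℕ) :
    {ρ | InSchmidt d r ρ} =
      convexHull ℝ ((fun ψ => Matrix.vecMulVec ψ (star ψ)) '' schmidtUnitVectors d r) := by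
  ext ρ
  constructor
  · rintro ⟨n, p, ψ, hp, hp1, hψ, hr, rfl⟩
    exact mem_convexHull_of_exists_fintype p _ hp hp1
      (fun k => Set.mem_image_of_mem _ ⟨hψ k, hr k⟩) (by simp [Complex.coe_smul])
  · intro hρ
    obtain ⟨ι, _, w, z, hw, hw1, hz, rfl⟩ := mem_convexHull_iff_exists_fintype.1 hρ
    choose ψ hψ hψz using hz
    let e := (Fintype.equivFin ι).symm
    refine ⟨Fintype.card ι, w ∘ e, ψ ∘ e, fun k => hw _, ?_, fun k => (hψ _).1,
      fun k => (hψ _).2, ?_⟩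
    · rw [← hw1]
      exact e.sum_comp w
    · rw [← e.sum_comp]
      simp [← hψz, Complex.coe_smul]

theorem convex_setOf_inSchmidt (d r : ℕ) : Convex ℝ {ρ | InSchmidt d r ρ} := by
  rw [setOf_inSchmidt_eq_convexHull]
  exact convex_convexHull ℝ _

theorem isClosed_setOf_inSchmidt (d r : ℕ) : IsClosed {ρ | InSchmidt d r ρ} := by
  rw [setOf_inSchmidt_eq_convexHull]
  exact (isCompact_convexHull_of_isCompact
    ((isCompact_schmidtUnitVectors d r).image (by fun_prop))).isClosed

theorem InSchmidt.isHermitian {d r : ℕ} {ρ : MatD d} (h : InSchmidt d r ρ) : ρ.IsHermitian := by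
  obtain ⟨n, p, ψ, -, -, -, -, rfl⟩ := h
  simp [Matrix.IsHermitian, Matrix.conjTranspose_sum, Matrix.conjTranspose_smul,
    Matrix.conjTranspose_vecMulVec]

theorem linearMap_apply_eq_trace_mul {n : Type*} [Fintype n] [DecidableEq n]
    (f : Matrix n n ℂ →ₗ[ℂ] ℂ) (M : Matrix n n ℂ) :
    f M = ((Matrix.of fun i j => f (Matrix.single j i 1)) * M).trace := by
  conv_lhs => rw [Matrix.matrix_eq_sum_single M]
  rw [Matrix.trace_mul_comm]
  simp only [map_sum, Matrix.trace, Matrix.diag, Matrix.mul_apply, Matrix.of_apply]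
  refine Finset.sum_congr rfl fun i _ => Finset.sum_congr rfl fun j _ => ?_
  rw [← smul_eq_mul, ← map_smul, Matrix.smul_single, smul_eq_mul, mul_one]

/-- On Hermitian matrices, the real part of `Tr (A ·)` only depends on the Hermitian part of `A`. -/
theorem re_trace_hermitianPart_mul {n : Type*} [Fintype n] (A : Matrix n n ℂ) {M : Matrix n n ℂ}
    (hM : M.IsHermitian) :
    (((1 / 2 : ℂ) • (A + Aᴴ) * M).trace).re = ((A * M).trace).re := by
  have h : (Aᴴ * M).trace = star (A * M).trace := by
    rw [← Matrix.trace_conjTranspose, Matrix.conjTranspose_mul, hM.eq, Matrix.trace_mul_comm]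
  rw [Matrix.smul_mul, Matrix.add_mul, Matrix.trace_smul, Matrix.trace_add, h]
  simp
  ring

/-- A Hermitian matrix outside the set of states of Schmidt number at most `r` is strictly
separated from it by a Hermitian matrix. -/
theorem exists_isHermitian_separating_inSchmidt {d r : ℕ} {τ : MatD d} (hτ : τ.IsHermitian)
    (hτn : ¬ InSchmidt d r τ) :
    ∃ (H : MatD d) (u : ℝ), H.IsHermitian ∧ ((H * τ).trace).re < u ∧
      ∀ ρ, InSchmidt d r ρ → u < ((H * ρ).trace).re := by
  have : LocallyConvexSpace ℝ (MatD d) :=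
    inferInstanceAs (LocallyConvexSpace ℝ (Fin d × Fin d → Fin d × Fin d → ℂ))
  obtain ⟨f, u, hfτ, hf⟩ := RCLike.geometric_hahn_banach_point_closed (𝕜 := ℂ)
    (convex_setOf_inSchmidt d r) (isClosed_setOf_inSchmidt d r) hτn
  let A : MatD d := Matrix.of fun i j => f (Matrix.single j i 1)
  have hA : ∀ M : MatD d, f M = (A * M).trace := linearMap_apply_eq_trace_mul f.toLinearMap
  refine ⟨(1 / 2 : ℂ) • (A + Aᴴ), u, ?_, ?_, fun ρ hρ => ?_⟩
  · simp [Matrix.IsHermitian, Matrix.conjTranspose_smul, add_comm]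
  · rw [re_trace_hermitianPart_mul A hτ, ← hA]
    exact hfτ
  · rw [re_trace_hermitianPart_mul A hρ.isHermitian, ← hA]
    exact hf ρ hρ

/-- existence of a Hermitian witness separating a state `σ ∉ r`-ABSN
from the (convex, closed) set `r`-ABSN. -/
theorem absn_witness_exists (d r : ℕ) (hd : 1 ≤ d) (hr : 1 ≤ r)
    (σ : MatD d) (hσ : IsDensity d σ) (hσn : ¬ InABSN d r σ) :
    ∃ W : MatD d, W.IsHermitian ∧
      (∀ ρ : MatD d, InABSN d r ρ → 0 ≤ ((W * ρ).trace).re) ∧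
      ((W * σ).trace).re < 0 := by
  obtain ⟨U, hU, hUσ⟩ : ∃ U ∈ Matrix.unitaryGroup (Fin d × Fin d) ℂ,
      ¬ InSchmidt d r (U * σ * star U) := by
    by_contra! h
    exact hσn ⟨hσ, h⟩
  obtain ⟨H, u, hH, hHσ, hHρ⟩ := exists_isHermitian_separating_inSchmidt
    (Matrix.isHermitian_mul_mul_conjTranspose U hσ.1.isHermitian) hUσ
  have hW : ∀ ρ : MatD d, ρ.trace = 1 →
      (((star U * H * U - (u : ℂ) • (1 : MatD d)) * ρ).trace).re
        = ((H * (U * ρ * star U)).trace).re - u := fun ρ hρ => by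
    have hcycle : (star U * H * U * ρ).trace = (H * (U * ρ * star U)).trace := by
      rw [Matrix.mul_assoc, Matrix.mul_assoc, Matrix.trace_mul_comm]
      simp only [Matrix.mul_assoc]
    rw [Matrix.sub_mul, Matrix.trace_sub, hcycle, Matrix.smul_mul, Matrix.one_mul,
      Matrix.trace_smul, hρ]
    simp
  refine ⟨star U * H * U - (u : ℂ) • (1 : MatD d), ?_, fun ρ hρ => ?_, ?_⟩
  · refine (Matrix.isHermitian_conjTranspose_mul_mul U hH).sub ?_
    simp [Matrix.IsHermitian, Matrix.conjTranspose_smul]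
  · rw [hW ρ hρ.1.2]
    exact sub_nonneg.2 (hHρ _ (hρ.2 U hU)).le
  · rw [hW σ hσ.2]
    exact sub_neg.2 hHσ
end

section
/- Convexity of the generalized r-absolute Schmidt robustness: for all density matrices ρ₁, ρ₂ on ℂ^d ⊗ ℂ^d and every p ∈ [0,1], M_GR(p·ρ₁ + (1−p)·ρ₂) ≤ p·M_GR(ρ₁) + (1−p)·M_GR(ρ₂). -/
open Matrix BigOperators
open scoped ComplexOrder

/-- The generalized `r`-absolute Schmidt robustness: the infimum (in `[0,∞]`) of
`t ≥ 0` such that `(ρ + t χ)/(1+t) ∈ r`-ABSN for some density matrix `χ`. -/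
noncomputable def MGR (d r : ℕ) (ρ : MatD d) : ENNReal :=
  sInf {s : ENNReal | ∃ t : ℝ, 0 ≤ t ∧ s = ENNReal.ofReal t ∧
    ∃ χ : MatD d, IsDensity d χ ∧ InABSN d r ((1 / (1 + t)) • (ρ + t • χ))}


theorem convex_isDensity (d : ℕ) : Convex ℝ {ρ : MatD d | IsDensity d ρ} := by
  rintro ρ ⟨hρ, hρt⟩ σ ⟨hσ, hσt⟩ a b ha hb hab
  refine ⟨(hρ.smul ha).add (hσ.smul hb), ?_⟩
  rw [Matrix.trace_add, Matrix.trace_smul, Matrix.trace_smul, hρt, hσt, ← add_smul, hab, one_smul]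

theorem convex_inSchmidt (d r : ℕ) : Convex ℝ {ρ : MatD d | InSchmidt d r ρ} := by
  rintro ρ ⟨m, p, ψ, hp, hp1, hψ, hψr, rfl⟩ σ ⟨n, q, φ, hq, hq1, hφ, hφr, rfl⟩ a b ha hb hab
  refine ⟨m + n, Fin.append (fun k => a * p k) (fun k => b * q k), Fin.append ψ φ, ?_, ?_, ?_, ?_, ?_⟩
  · exact Fin.addCases (by simpa using fun k => mul_nonneg ha (hp k))
      (by simpa using fun k => mul_nonneg hb (hq k))
  · simp [Fin.sum_univ_add, ← Finset.mul_sum, hp1, hq1, hab]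
  · exact Fin.addCases (by simpa using hψ) (by simpa using hφ)
  · exact Fin.addCases (by simpa using hψr) (by simpa using hφr)
  · simp only [Fin.sum_univ_add, Fin.append_left, Fin.append_right, Finset.smul_sum,
      mul_smul, Complex.coe_smul]

theorem convex_inABSN (d r : ℕ) : Convex ℝ {ρ : MatD d | InABSN d r ρ} := by
  rintro ρ ⟨hρ, hρU⟩ σ ⟨hσ, hσU⟩ a b ha hb hab
  refine ⟨convex_isDensity d hρ hσ ha hb hab, fun U hU => ?_⟩
  have h := convex_inSchmidt d r (hρU U hU) (hσU U hU) ha hb hab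
  simpa [Matrix.mul_add, Matrix.add_mul] using h

/-- `t` is the weight of some admixture of a density matrix taking `ρ` into `r`-ABSN. -/
def IsAdmissibleWeight (d r : ℕ) (ρ : MatD d) (t : ℝ) : Prop :=
  0 ≤ t ∧ ∃ χ : MatD d, IsDensity d χ ∧ InABSN d r ((1 / (1 + t)) • (ρ + t • χ))

theorem IsAdmissibleWeight.convex_comb {d r : ℕ} {ρ σ : MatD d} {s t a b : ℝ}
    (hs : IsAdmissibleWeight d r ρ s) (ht : IsAdmissibleWeight d r σ t)
    (ha : 0 < a) (hb : 0 < b) (hab : a + b = 1) :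
    IsAdmissibleWeight d r (a • ρ + b • σ) (a * s + b * t) := by
  obtain ⟨hs0, χ, hχ, hχA⟩ := hs
  obtain ⟨ht0, ω, hω, hωA⟩ := ht
  have hu0 : 0 ≤ a * s + b * t := by positivity
  refine ⟨hu0, ?_⟩
  obtain ⟨τ, hτ, hτeq⟩ : ∃ τ : MatD d, IsDensity d τ ∧
      (a * s + b * t) • τ = (a * s) • χ + (b * t) • ω := by
    rcases hu0.eq_or_lt with hu | hu
    · have h1 : a * s = 0 := by nlinarith [mul_nonneg ha.le hs0, mul_nonneg hb.le ht0]
      have h2 : b * t = 0 := by nlinarith [mul_nonneg ha.le hs0, mul_nonneg hb.le ht0]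
      exact ⟨χ, hχ, by simp [h1, h2]⟩
    · refine ⟨(a * s / (a * s + b * t)) • χ + (b * t / (a * s + b * t)) • ω,
        convex_isDensity d hχ hω (by positivity) (by positivity) (by field_simp), ?_⟩
      rw [smul_add, smul_smul, smul_smul, mul_div_cancel₀ _ hu.ne', mul_div_cancel₀ _ hu.ne']
  refine ⟨τ, hτ, ?_⟩
  have hu : 0 < 1 + (a * s + b * t) := by positivity
  have hs1 : 0 < 1 + s := by positivity
  have ht1 : 0 < 1 + t := by positivity
  have h := convex_inABSN d r hχA hωA
    (a := a * (1 + s) / (1 + (a * s + b * t))) (b := b * (1 + t) / (1 + (a * s + b * t)))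
    (by positivity) (by positivity)
    (by rw [← add_div, div_eq_one_iff_eq hu.ne']; linear_combination hab)
  have heq : (1 / (1 + (a * s + b * t))) • (a • ρ + b • σ + (a * s + b * t) • τ) =
      (a * (1 + s) / (1 + (a * s + b * t))) • ((1 / (1 + s)) • (ρ + s • χ)) +
        (b * (1 + t) / (1 + (a * s + b * t))) • ((1 / (1 + t)) • (σ + t • ω)) := by
    rw [hτeq]
    match_scalars <;> field_simp
  rw [heq]
  exact h

theorem MGR_eq_iInf (d r : ℕ) (ρ : MatD d) :
    MGR d r ρ = ⨅ t : {t : ℝ // IsAdmissibleWeight d r ρ t}, ENNReal.ofReal t := by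
  rw [MGR, iInf]
  congr 1
  ext s
  constructor
  · rintro ⟨t, h0, rfl, h⟩
    exact ⟨⟨t, h0, h⟩, rfl⟩
  · rintro ⟨⟨t, h0, h⟩, rfl⟩
    exact ⟨t, h0, rfl, h⟩

/-- convexity of the generalized `r`-absolute Schmidt robustness. -/
theorem MGR_convex (d r : ℕ) (hd : 1 ≤ d) (hr : 1 ≤ r)
    (ρ₁ ρ₂ : MatD d) (h₁ : IsDensity d ρ₁) (h₂ : IsDensity d ρ₂)
    (p : ℝ) (hp : p ∈ Set.Icc (0 : ℝ) 1) :
    MGR d r (p • ρ₁ + (1 - p) • ρ₂) ≤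
      ENNReal.ofReal p * MGR d r ρ₁ + ENNReal.ofReal (1 - p) * MGR d r ρ₂ := by
  obtain ⟨hp0, hp1⟩ := hp
  rcases hp0.eq_or_lt with rfl | hp0
  · simp
  rcases hp1.eq_or_lt with rfl | hp1
  · simp
  have hq0 : 0 < 1 - p := sub_pos.2 hp1
  simp only [MGR_eq_iInf]
  rw [ENNReal.mul_iInf_of_ne (ENNReal.ofReal_pos.2 hp0).ne' ENNReal.ofReal_ne_top,
    ENNReal.mul_iInf_of_ne (ENNReal.ofReal_pos.2 hq0).ne' ENNReal.ofReal_ne_top]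
  refine ENNReal.le_iInf_add_iInf fun s t => ?_
  rw [← ENNReal.ofReal_mul hp0.le, ← ENNReal.ofReal_mul hq0.le,
    ← ENNReal.ofReal_add (mul_nonneg hp0.le s.2.1) (mul_nonneg hq0.le t.2.1)]
  exact iInf_le_of_le ⟨_, s.2.convex_comb t.2 hp0 hq0 (by ring)⟩ le_rfl
end
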